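/- arXiv:cs/0110031 — 3 statements merged into one kernel-verified Lean document; each statement's English description precedes it below -/
import Mathlib

section
/- Let n ≥ 2 and suppose that over the field of complex numbers S_n^2(X) = Σ_{i=1}^r Π_{j=1}^{s_i} L_{ij}(X), where each L_{ij} is an affine linear form in X_1,…,X_n with complex coefficients (the circuit need not be homogeneous). Then r ≥ ⌈n/2⌉. -/
open MvPolynomial

/-- The second elementary symmetric polynomial `∑_{i < j} X_i X_j` in `n` variables. -/
noncomputable def esym2 (F : Type*) [CommRing F] (n : ℕ) : MvPolynomial (Fin n) F :=
  ∑ p ∈ Finset.univ.filter (fun p : Fin n × Fin n => p.1 < p.2), X p.1 * X p.2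

/-- Finitely many products of affine forms become simultaneously constant on some affine subspace
whose codimension is at most the number of products. -/
theorem exists_affine_subspace_prod_const {K V ι : Type*} [Field K] [AddCommGroup V] [Module K V]
    [FiniteDimensional K V] {s : ι → ℕ} (c : (i : ι) → Fin (s i) → K)
    (f : (i : ι) → Fin (s i) → V →ₗ[K] K) (t : Finset ι) :
    ∃ (v : V) (W : Submodule K V), Module.finrank K V ≤ Module.finrank K W + t.card ∧
      ∀ i ∈ t, ∀ w ∈ W, ∏ j, (c i j + f i j (v + w)) = ∏ j, (c i j + f i j v) := by
  classical
  induction t using Finset.induction_on with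
  | empty => exact ⟨0, ⊤, by simp, by simp⟩
  | insert i t hi ih =>
    obtain ⟨v, W, hW, hc⟩ := ih
    rw [Finset.card_insert_of_notMem hi]
    by_cases hz : ∀ j, ∀ w ∈ W, f i j w = 0
    · refine ⟨v, W, by lia, fun k hk w hw => ?_⟩
      rcases Finset.mem_insert.mp hk with rfl | hk
      · exact Finset.prod_congr rfl fun j _ => by rw [map_add, hz j w hw, add_zero]
      · exact hc k hk w hw
    · push Not at hz
      obtain ⟨j, u, hu, hne⟩ := hz
      have hroot : ∃ u' ∈ W, c i j + f i j (v + u') = 0 := by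
        refine ⟨(-(c i j + f i j v) / f i j u) • u, W.smul_mem _ hu, ?_⟩
        rw [map_add, map_smul, smul_eq_mul, div_mul_cancel₀ _ hne]
        ring
      obtain ⟨u', hu', hroot⟩ := hroot
      refine ⟨v + u', W ⊓ LinearMap.ker (f i j), ?_, fun k hk w hw => ?_⟩
      · have hker := Module.Dual.finrank_ker_add_one_of_ne_zero (f := f i j)
          (fun h0 => hne (by rw [h0]; rfl))
        have hdim := Submodule.finrank_sup_add_finrank_inf_eq W (LinearMap.ker (f i j))
        have hle := Submodule.finrank_le (W ⊔ LinearMap.ker (f i j))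
        lia
      · obtain ⟨hwW, hwk⟩ := Submodule.mem_inf.mp hw
        rcases Finset.mem_insert.mp hk with rfl | hk
        · have hroot' : c k j + f k j (v + u' + w) = 0 := by
            rw [map_add, LinearMap.mem_ker.mp hwk, add_zero, hroot]
          rw [Finset.prod_eq_zero (Finset.mem_univ j) hroot',
            Finset.prod_eq_zero (Finset.mem_univ j) hroot]
        · rw [add_assoc, hc k hk _ (W.add_mem hu' hwW), hc k hk _ hu']

theorem two_mul_eval_esym2 {F : Type*} [CommRing F] (n : ℕ) (x : Fin n → F) :
    2 * eval x (esym2 F n) = (∑ i, x i) * (∑ i, x i) - ∑ i, x i * x i := by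
  have hlt : eval x (esym2 F n) = ∑ i, ∑ j, if i < j then x i * x j else 0 := by
    simp [esym2, Finset.sum_filter, Fintype.sum_prod_type, apply_ite (eval x)]
  have hgt : eval x (esym2 F n) = ∑ i, ∑ j, if j < i then x i * x j else 0 := by
    rw [hlt, Finset.sum_comm]
    simp only [mul_comm]
  have hdiag : ∑ i, x i * x i = ∑ i, ∑ j, if i = j then x i * x j else 0 := by simp
  rw [two_mul, eq_sub_iff_add_eq]
  nth_rewrite 1 [hlt]
  rw [hgt, hdiag, Finset.sum_mul_sum, ← Finset.sum_add_distrib, ← Finset.sum_add_distrib]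
  refine Finset.sum_congr rfl fun i _ => ?_
  rw [← Finset.sum_add_distrib, ← Finset.sum_add_distrib]
  refine Finset.sum_congr rfl fun j _ => ?_
  rcases lt_trichotomy i j with hij | rfl | hij
  · simp [hij, hij.not_gt, hij.ne]
  · simp
  · simp [hij, hij.not_gt, hij.ne']

/-- The polar form of `S_n^2`. -/
noncomputable def esym2Polar (F : Type*) [CommRing F] (n : ℕ) : LinearMap.BilinForm F (Fin n → F) :=
  LinearMap.mk₂ F (fun x y => (∑ i, x i) * (∑ i, y i) - ∑ i, x i * y i)
    (fun x x' y => by simp [Finset.sum_add_distrib, add_mul]; ring)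
    (fun a x y => by simp [← Finset.mul_sum, mul_assoc, mul_sub])
    (fun x y y' => by simp [Finset.sum_add_distrib, mul_add]; ring)
    (fun a x y => by simp [← Finset.mul_sum, mul_left_comm, mul_sub])

theorem esym2Polar_apply {F : Type*} [CommRing F] {n : ℕ} (x y : Fin n → F) :
    esym2Polar F n x y = (∑ i, x i) * (∑ i, y i) - ∑ i, x i * y i := rfl

theorem esym2Polar_isSymm (F : Type*) [CommRing F] (n : ℕ) : (esym2Polar F n).IsSymm :=
  ⟨fun x y => by simp [esym2Polar_apply, mul_comm]⟩

theorem esym2Polar_nondegenerate {F : Type*} [Field F] [CharZero F] {n : ℕ} (hn : 2 ≤ n) :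
    (esym2Polar F n).Nondegenerate := by
  refine (esym2Polar_isSymm F n).isRefl.nondegenerate_iff_separatingLeft.mpr ?_
  intro x hx
  have hcoord : ∀ k, x k = ∑ i, x i := fun k => by
    have hk := hx (Pi.single k 1)
    simp only [esym2Polar_apply, Finset.mem_univ, if_true, Pi.single_apply,
      mul_ite, mul_one, mul_zero, Finset.sum_ite_eq'] at hk
    exact (sub_eq_zero.mp hk).symm
  have hsum : ∑ i, x i = n * ∑ i, x i := by
    conv_lhs => rw [Finset.sum_congr rfl fun k _ => hcoord k]
    simp
  have hn1 : (n : F) - 1 ≠ 0 := sub_ne_zero.mpr (by exact_mod_cast (by lia : n ≠ 1))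
  have hzero : ∑ i, x i = 0 := by
    have : ((n : F) - 1) * ∑ i, x i = 0 := by linear_combination -hsum
    exact (mul_eq_zero.mp this).resolve_left hn1
  funext k
  rw [hcoord k, hzero, Pi.zero_apply]

/-- If a (possibly inhomogeneous) ΣΠΣ circuit with `r` multiplication gates computes
`S_n^2` over ℂ, then `r ≥ ⌈n/2⌉`. -/
theorem stmt_2 (n r : ℕ) (hn : 2 ≤ n) (s : Fin r → ℕ)
    (c : (i : Fin r) → Fin (s i) → ℂ)
    (a : (i : Fin r) → Fin (s i) → Fin n → ℂ)
    (h : esym2 ℂ n =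
      ∑ i : Fin r, ∏ j : Fin (s i), (C (c i j) + ∑ k : Fin n, C (a i j k) * X k)) :
    (n + 1) / 2 ≤ r := by
  obtain ⟨v, W, hW, hc⟩ := exists_affine_subspace_prod_const c
    (fun i j => dotProductBilin ℂ ℂ (a i j)) Finset.univ
  have heval : ∀ x, eval x (esym2 ℂ n) =
      ∑ i, ∏ j, (c i j + dotProductBilin ℂ ℂ (a i j) x) := fun x => by
    rw [h]
    simp [dotProduct]
  have hconst : ∀ w ∈ W, esym2Polar ℂ n (v + w) (v + w) = esym2Polar ℂ n v v := fun w hw => by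
    rw [esym2Polar_apply, esym2Polar_apply, ← two_mul_eval_esym2, ← two_mul_eval_esym2,
      heval, heval, Finset.sum_congr rfl fun i _ => hc i (Finset.mem_univ i) w hw]
  have hisotropic : ∀ w ∈ W, esym2Polar ℂ n w w = 0 := fun w hw => by
    have hpos := hconst w hw
    have hneg := hconst (-w) (W.neg_mem hw)
    simp only [map_add, map_neg, LinearMap.add_apply, LinearMap.neg_apply] at hpos hneg
    linear_combination (hpos + hneg) / 2
  have horth : W ≤ (esym2Polar ℂ n).orthogonal W := fun w hw u hu => by
    have hadd := hisotropic _ (W.add_mem hu hw)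
    have hsymm := (esym2Polar_isSymm ℂ n).eq u w
    simp only [map_add, LinearMap.add_apply, hisotropic u hu, hisotropic w hw] at hadd hsymm
    change esym2Polar ℂ n u w = 0
    linear_combination (hadd + hsymm) / 2
  have hle := Submodule.finrank_mono horth
  rw [LinearMap.BilinForm.finrank_orthogonal (esym2Polar_nondegenerate hn)] at hle
  simp only [Module.finrank_fin_fun, Finset.card_univ, Fintype.card_fin] at hW hle
  lia
end

section
/- Let p ≥ 3 be an odd integer. (a) If there exists an n × n matrix good for p, then the complete graph K_{2n} admits a 1 mod p cover by n complete bipartite subgraphs. (b) If n = q² + q + 1 where q is a prime power with q ≡ -1 (mod 2p), then an n × n matrix good for p exists. -/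
/-- For an odd integer `p`, an `n × n` integer matrix is *good for `p`* if its entries lie in
`{-1, 0, 1}`, every row has a number of non-zero entries congruent to `1 mod p`, every pair
of distinct rows has a number of columns where both are non-zero congruent to `2 mod 2p`,
and distinct rows are orthogonal over ℤ. -/
def IsGoodMatrixFor (p : ℕ) {n : ℕ} (M : Matrix (Fin n) (Fin n) ℤ) : Prop :=
  (∀ i j, M i j = -1 ∨ M i j = 0 ∨ M i j = 1) ∧
  (∀ i, (Finset.univ.filter (fun j => M i j ≠ 0)).card % p = 1) ∧
  (∀ i i', i ≠ i' →
    (Finset.univ.filter (fun j => M i j ≠ 0 ∧ M i' j ≠ 0)).card % (2 * p) = 2) ∧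
  (∀ i i', i ≠ i' → ∑ j, M i j * M i' j = 0)

/-- `A, B : Fin r → Finset (Fin n)` describe a `1 mod p` cover of the complete graph `K_n`
by `r` complete bipartite subgraphs: the colour classes `A i` and `B i` are disjoint, and
every edge `{u, v}` (`u ≠ v`) is covered a number of times congruent to `1` modulo `p`. -/
def IsOneModPCover (p n r : ℕ) (A B : Fin r → Finset (Fin n)) : Prop :=
  (∀ i, Disjoint (A i) (B i)) ∧
  ∀ u v : Fin n, u ≠ v →
    (Finset.univ.filter
      (fun i : Fin r => (u ∈ A i ∧ v ∈ B i) ∨ (v ∈ A i ∧ u ∈ B i))).card % p = 1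

/-- For distinct rows of a good matrix, the number of columns with equal non-zero entries and the
number of columns with opposite non-zero entries are both congruent to `1` modulo `p`. -/
theorem card_filter_mul_eq_mod {p n : ℕ} {M : Matrix (Fin n) (Fin n) ℤ}
    (hM : IsGoodMatrixFor p M) {i i' : Fin n} (hii' : i ≠ i') :
    (Finset.univ.filter fun j => M i j * M i' j = 1).card % p = 1 ∧
      (Finset.univ.filter fun j => M i j * M i' j = -1).card % p = 1 := by
  obtain ⟨hentry, -, hcommon, horth⟩ := hM
  set a := (Finset.univ.filter fun j => M i j * M i' j = 1).card with ha
  set b := (Finset.univ.filter fun j => M i j * M i' j = -1).card with hb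
  have hsum : a + b = (Finset.univ.filter fun j => M i j ≠ 0 ∧ M i' j ≠ 0).card := by
    simp only [ha, hb, Finset.card_filter, ← Finset.sum_add_distrib]
    refine Finset.sum_congr rfl fun j _ => ?_
    rcases hentry i j with h | h | h <;> rcases hentry i' j with h' | h' | h' <;> simp [h, h']
  have hdiff : (a : ℤ) - b = 0 := by
    rw [← horth i i' hii']
    simp only [ha, hb, Finset.card_filter, Nat.cast_sum, ← Finset.sum_sub_distrib]
    refine Finset.sum_congr rfl fun j _ => ?_
    rcases hentry i j with h | h | h <;> rcases hentry i' j with h' | h' | h' <;> simp [h, h']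
  have hab : a = b := by lia
  have hmod := hcommon i i' hii'
  rw [← hsum, ← hab, ← two_mul, Nat.mul_mod_mul_left] at hmod
  rw [← hab]
  lia

/-- A good `n × n` matrix yields a `1 mod p` cover of `K_{2n}` by `n` bicliques. -/
theorem IsGoodMatrixFor.exists_isOneModPCover {p n : ℕ}
    {M : Matrix (Fin n) (Fin n) ℤ} (hM : IsGoodMatrixFor p M) :
    ∃ A B : Fin n → Finset (Fin (2 * n)), IsOneModPCover p (2 * n) n A B := by
  classical
  let e : Fin (2 * n) ≃ Fin 2 × Fin n := finProdFinEquiv.symm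
  let s : Fin 2 → ℤ := ![1, -1]
  refine ⟨fun j => Finset.univ.filter fun u => s (e u).1 * M (e u).2 j = 1,
    fun j => Finset.univ.filter fun u => s (e u).1 * M (e u).2 j = -1, fun j => ?_,
    fun u v huv => ?_⟩
  · rw [Finset.disjoint_left]
    intro u hu hu'
    simp only [Finset.mem_filter, Finset.mem_univ, true_and] at hu hu'
    lia
  · have huv' : e u ≠ e v := e.injective.ne huv
    simp only [Finset.mem_filter, Finset.mem_univ, true_and]
    generalize e u = x at huv'
    generalize e v = y at huv'
    obtain ⟨a, i⟩ := x
    obtain ⟨b, i'⟩ := y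
    have hentry := hM.1
    by_cases hii' : i = i'
    · subst hii'
      have hab : a ≠ b := fun h => huv' (by rw [h])
      rw [← hM.2.1 i]
      congr 2
      ext j
      simp only [Finset.mem_filter, Finset.mem_univ, true_and]
      fin_cases a <;> fin_cases b <;> rcases hentry i j with h | h | h <;> simp_all [s]
    · obtain ⟨hpos, hneg⟩ := card_filter_mul_eq_mod hM hii'
      by_cases hab : a = b
      · rw [← hneg]
        congr 2
        ext j
        simp only [Finset.mem_filter, Finset.mem_univ, true_and]
        subst hab
        fin_cases a <;> rcases hentry i j with h | h | h <;> rcases hentry i' j with h' | h' | h' <;>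
          simp [s, h, h']
      · rw [← hpos]
        congr 2
        ext j
        simp only [Finset.mem_filter, Finset.mem_univ, true_and]
        fin_cases a <;> fin_cases b <;> rcases hentry i j with h | h | h <;>
          rcases hentry i' j with h' | h' | h' <;> simp_all [s]

/-- Summing a function over a surjective additive homomorphism. -/
theorem card_mul_sum_comp_of_surjective {V W : Type*} [AddCommGroup V] [AddCommGroup W]
    [Fintype V] [Fintype W] (L : V →+ W) (hL : Function.Surjective L) (g : W → ℤ) :
    (Fintype.card W : ℤ) * ∑ v, g (L v) = Fintype.card V * ∑ w, g w := by
  have hshift (w : W) : ∑ v, g (L v + w) = ∑ v, g (L v) := by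
    obtain ⟨t, rfl⟩ := hL w
    simpa using Equiv.sum_comp (Equiv.addRight t) fun v => g (L v)
  calc (Fintype.card W : ℤ) * ∑ v, g (L v) = ∑ w, ∑ v, g (L v + w) := by simp [hshift]
    _ = ∑ v, ∑ w, g (L v + w) := Finset.sum_comm
    _ = ∑ _v : V, ∑ w, g w :=
      Finset.sum_congr rfl fun v _ => Equiv.sum_comp (Equiv.addLeft (L v)) g
    _ = Fintype.card V * ∑ w, g w := by simp

open scoped LinearAlgebra.Projectivization

/-- Summing a scaling-invariant function over a projective space. -/
theorem sum_eq_card_units_mul_sum_projectivization {F V : Type*} [Field F] [Fintype F]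
    [DecidableEq F] [AddCommGroup V] [Module F V] [Fintype V] [Fintype (ℙ F V)] (f : V → ℤ)
    (hzero : f 0 = 0) (hsmul : ∀ (c : Fˣ) (v : V), f (c • v) = f v) :
    ∑ v, f v = ((Fintype.card F : ℤ) - 1) * ∑ P : ℙ F V, f P.rep := by
  classical
  let φ : Fˣ × ℙ F V → {v : V // v ≠ 0} := fun x =>
    ⟨x.1 • x.2.rep, (smul_ne_zero_iff_ne x.1).2 x.2.rep_nonzero⟩
  have hφ : Function.Bijective φ := by
    constructor
    · rintro ⟨c, P⟩ ⟨d, Q⟩ h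
      have h' : c • P.rep = d • Q.rep := congrArg Subtype.val h
      obtain rfl : P = Q := by
        rw [← P.mk_rep, ← Q.mk_rep, Projectivization.mk_eq_mk_iff]
        exact ⟨c⁻¹ * d, by rw [mul_smul, ← h', inv_smul_smul]⟩
      have hcd : (c : F) = d := smul_left_injective F P.rep_nonzero h'
      rw [Units.ext hcd]
    · rintro ⟨v, hv⟩
      obtain ⟨a, ha⟩ := Projectivization.exists_smul_eq_mk_rep F v hv
      exact ⟨(a⁻¹, Projectivization.mk F v hv), Subtype.ext (by simp [φ, ← ha])⟩
  calc ∑ v, f v = ∑ v : {v : V // v ≠ 0}, f v := by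
        rw [← Finset.sum_erase _ hzero]
        exact Finset.sum_subtype _ (by simp) f
    _ = ∑ x : Fˣ × ℙ F V, f x.2.rep :=
        (Fintype.sum_bijective φ hφ _ _ fun x => (hsmul x.1 x.2.rep).symm).symm
    _ = ((Fintype.card F : ℤ) - 1) * ∑ P : ℙ F V, f P.rep := by
        rw [Fintype.sum_prod_type]
        simp [Fintype.card_units, Nat.cast_sub Fintype.card_pos]

theorem dotProduct_pair_surjective {F : Type*} [Field F] {x y : Fin 3 → F}
    (h : LinearIndependent F ![x, y]) :
    Function.Surjective fun v => (x ⬝ᵥ v, y ⬝ᵥ v) := by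
  have hrank : (Matrix.of ![x, y]).rank = 2 := by
    simpa using LinearIndependent.rank_matrix (M := Matrix.of ![x, y]) h
  have hsurj : Function.Surjective (Matrix.of ![x, y]).mulVecLin := by
    rw [← LinearMap.range_eq_top]
    apply Submodule.eq_top_of_finrank_eq
    simpa [Matrix.rank] using hrank
  rintro ⟨a, b⟩
  obtain ⟨v, hv⟩ := hsurj ![a, b]
  refine ⟨v, Prod.ext ?_ ?_⟩
  · simpa [Matrix.mulVec] using congrFun hv 0
  · simpa [Matrix.mulVec] using congrFun hv 1

section QuadraticCharacter

variable {F : Type*} [Field F] [Fintype F] [DecidableEq F]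

theorem sum_quadraticChar_sq : ∑ a : F, quadraticChar F a ^ 2 = (Fintype.card F : ℤ) - 1 := by
  have h (a : F) : quadraticChar F a ^ 2 = 1 - if a = 0 then 1 else 0 := by
    by_cases ha : a = 0
    · simp [ha]
    · simp [ha, quadraticChar_sq_one ha, -quadraticChar_apply]
  simp [h, -quadraticChar_apply]

/-- The matrix of quadratic characters of the pairings between points of the projective plane. -/
noncomputable def projectiveCharMatrix (F : Type*) [Field F] [Fintype F] [DecidableEq F] :
    Matrix (ℙ F (Fin 3 → F)) (ℙ F (Fin 3 → F)) ℤ :=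
  Matrix.of fun P Q => quadraticChar F (P.rep ⬝ᵥ Q.rep)

theorem projectiveCharMatrix_sq_eq (P Q : ℙ F (Fin 3 → F)) :
    projectiveCharMatrix F P Q ^ 2 = if projectiveCharMatrix F P Q ≠ 0 then 1 else 0 := by
  unfold projectiveCharMatrix
  by_cases h : P.rep ⬝ᵥ Q.rep = 0
  · simp [h]
  · simp [h, quadraticChar_sq_one h, quadraticChar_eq_zero_iff, -quadraticChar_apply]

variable [Fintype (ℙ F (Fin 3 → F))]

/-- Sums over the projective plane of functions of two independent linear forms. -/
theorem mul_sum_projectivization_pair {P P' : ℙ F (Fin 3 → F)} (hPP' : P ≠ P') (g : F × F → ℤ)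
    (hzero : g 0 = 0) (hsmul : ∀ (c : Fˣ) (w : F × F), g (c • w) = g w) :
    ((Fintype.card F : ℤ) - 1) * ∑ Q : ℙ F (Fin 3 → F), g (P.rep ⬝ᵥ Q.rep, P'.rep ⬝ᵥ Q.rep) =
      Fintype.card F * ∑ w, g w := by
  let L : (Fin 3 → F) →+ F × F :=
    { toFun := fun v => (P.rep ⬝ᵥ v, P'.rep ⬝ᵥ v)
      map_zero' := by simp
      map_add' := fun v w => by simp [dotProduct_add] }
  have hind : LinearIndependent F ![P.rep, P'.rep] :=
    Projectivization.linearIndependent_pair_iff_ne.2 hPP'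
  have hL := card_mul_sum_comp_of_surjective L (dotProduct_pair_surjective hind) g
  have hproj := sum_eq_card_units_mul_sum_projectivization (F := F) (fun v => g (L v))
    (by simpa using hzero) fun c v => by
      rw [← hsmul c (L v)]
      congr 1
      simp [L, Units.smul_def, dotProduct_smul]
  have hq : (Fintype.card F : ℤ) ^ 2 ≠ 0 := by simp
  apply mul_left_cancel₀ hq
  change _ * (_ * ∑ Q : ℙ F (Fin 3 → F), g (L Q.rep)) = _
  rw [← hproj]
  simp only [Fintype.card_prod, Fintype.card_pi, Finset.prod_const, Finset.card_univ,
    Fintype.card_fin, Nat.cast_mul, Nat.cast_pow] at hL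
  linear_combination hL

/-- The squares of a row of `projectiveCharMatrix` sum to `q ^ 2`. -/
theorem sum_projectiveCharMatrix_sq (P : ℙ F (Fin 3 → F)) :
    ∑ Q, projectiveCharMatrix F P Q ^ 2 = (Fintype.card F : ℤ) ^ 2 := by
  obtain ⟨P', hPP'⟩ : ∃ P' : ℙ F (Fin 3 → F), P ≠ P' := by
    by_contra! h
    have h01 := (h (.mk F ![1, 0, 0] (by simp))).symm.trans (h (.mk F ![0, 1, 0] (by simp)))
    rw [Projectivization.mk_eq_mk_iff] at h01
    obtain ⟨a, ha⟩ := h01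
    simpa [Units.smul_def] using congrFun ha 0
  have h := mul_sum_projectivization_pair hPP' (fun w => quadraticChar F w.1 ^ 2) (by simp)
    fun c w => by simp [Units.smul_def, mul_pow, quadraticChar_sq_one c.ne_zero, -quadraticChar_apply]
  rw [Fintype.sum_prod_type] at h
  simp only [Finset.sum_const, Finset.card_univ, nsmul_eq_mul, ← Finset.mul_sum,
    sum_quadraticChar_sq] at h
  have hq : (Fintype.card F : ℤ) - 1 ≠ 0 := by
    have := Fintype.one_lt_card (α := F)
    lia
  apply mul_left_cancel₀ hq
  change _ * ∑ Q : ℙ F (Fin 3 → F), quadraticChar F (P.rep ⬝ᵥ Q.rep) ^ 2 = _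
  rw [h]
  ring

/-- The common support of two distinct rows of `projectiveCharMatrix` has `q (q - 1)` elements. -/
theorem sum_projectiveCharMatrix_sq_mul_sq {P P' : ℙ F (Fin 3 → F)} (hPP' : P ≠ P') :
    ∑ Q, projectiveCharMatrix F P Q ^ 2 * projectiveCharMatrix F P' Q ^ 2 =
      (Fintype.card F : ℤ) * (Fintype.card F - 1) := by
  have h := mul_sum_projectivization_pair hPP'
    (fun w => quadraticChar F w.1 ^ 2 * quadraticChar F w.2 ^ 2) (by simp)
    fun c w => by simp [Units.smul_def, mul_pow, quadraticChar_sq_one c.ne_zero, -quadraticChar_apply]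
  rw [Fintype.sum_prod_type] at h
  simp only [← Finset.mul_sum, ← Finset.sum_mul, sum_quadraticChar_sq] at h
  have hq : (Fintype.card F : ℤ) - 1 ≠ 0 := by
    have := Fintype.one_lt_card (α := F)
    lia
  apply mul_left_cancel₀ hq
  refine h.trans ?_
  ring

/-- In odd characteristic distinct rows of `projectiveCharMatrix` are orthogonal. -/
theorem sum_projectiveCharMatrix_mul (hF : ringChar F ≠ 2) {P P' : ℙ F (Fin 3 → F)}
    (hPP' : P ≠ P') : ∑ Q, projectiveCharMatrix F P Q * projectiveCharMatrix F P' Q = 0 := by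
  have h := mul_sum_projectivization_pair hPP'
    (fun w => quadraticChar F w.1 * quadraticChar F w.2) (by simp)
    fun c w => by
      have := quadraticChar_sq_one c.ne_zero
      simp only [Units.smul_def, Prod.smul_fst, Prod.smul_snd, smul_eq_mul, map_mul]
      linear_combination quadraticChar F w.1 * quadraticChar F w.2 * this
  rw [Fintype.sum_prod_type] at h
  simp only [← Finset.mul_sum, quadraticChar_sum_zero hF, mul_zero,
    Finset.sum_const_zero] at h
  have hq : (Fintype.card F : ℤ) - 1 ≠ 0 := by
    have := Fintype.one_lt_card (α := F)
    lia
  exact (mul_eq_zero.1 h).resolve_left hq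

end QuadraticCharacter

/-- A good matrix of order `q ^ 2 + q + 1` built from the projective plane over a finite field. -/
theorem exists_isGoodMatrixFor_of_field {p n : ℕ} (hp : 3 ≤ p) (F : Type*) [Field F] [Fintype F]
    (hmod : Fintype.card F % (2 * p) = 2 * p - 1)
    (hn : n = Fintype.card F ^ 2 + Fintype.card F + 1) :
    ∃ M : Matrix (Fin n) (Fin n) ℤ, IsGoodMatrixFor p M := by
  classical
  have : Fintype (ℙ F (Fin 3 → F)) := Fintype.ofFinite _
  have hcard : Fintype.card (ℙ F (Fin 3 → F)) = n := by
    rw [Fintype.card_eq_nat_card, Projectivization.card_of_finrank F (Fin 3 → F) (n := 3) (by simp),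
      hn, Nat.card_eq_fintype_card]
    simp only [Finset.sum_range_succ, Finset.sum_range_zero]
    ring
  let e : Fin n ≃ ℙ F (Fin 3 → F) := (Fintype.equivFinOfCardEq hcard).symm
  obtain ⟨m, hm⟩ : ∃ m, Fintype.card F + 1 = 2 * p * (m + 1) := by
    refine ⟨Fintype.card F / (2 * p), ?_⟩
    have := Nat.div_add_mod (Fintype.card F) (2 * p)
    rw [mul_add, mul_one]
    lia
  have hF : ringChar F ≠ 2 := by
    rw [Ne, FiniteField.even_card_iff_char_two]
    rw [mul_assoc] at hm
    lia
  obtain ⟨k, hk⟩ : ∃ k, Fintype.card F = k + 2 := ⟨Fintype.card F - 2, by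
    have := Fintype.one_lt_card (α := F)
    lia⟩
  refine ⟨(projectiveCharMatrix F).submatrix e e, fun i j => ?_, fun i => ?_, fun i i' hii' => ?_,
    fun i i' hii' => ?_⟩
  · change quadraticChar F ((e i).rep ⬝ᵥ (e j).rep) = -1 ∨ _ ∨ _
    by_cases h : (e i).rep ⬝ᵥ (e j).rep = 0
    · right; left
      change quadraticChar F ((e i).rep ⬝ᵥ (e j).rep) = 0
      simp [h]
    · exact (quadraticChar_dichotomy h).elim (fun h => .inr (.inr h)) .inl
  · have hsupp : (Finset.univ.filter fun j =>
        (projectiveCharMatrix F).submatrix e e i j ≠ 0).card = Fintype.card F ^ 2 := by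
      zify
      rw [← sum_projectiveCharMatrix_sq (e i), ← Equiv.sum_comp e, Finset.card_filter]
      push_cast
      refine Finset.sum_congr rfl fun j _ => ?_
      simp only [projectiveCharMatrix_sq_eq, Matrix.submatrix_apply]
      by_cases h : projectiveCharMatrix F (e i) (e j) = 0 <;> simp [h]
    have hsq : Fintype.card F ^ 2 = 1 + p * (2 * (m + 1) * (k + 1)) := by
      zify at hm hk ⊢
      linear_combination (k + 1 : ℤ) * hm + (Fintype.card F + 1 : ℤ) * hk
    rw [hsupp, hsq, Nat.add_mul_mod_self_left, Nat.mod_eq_of_lt (by lia)]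
  · have hsupp : (Finset.univ.filter fun j => (projectiveCharMatrix F).submatrix e e i j ≠ 0 ∧
        (projectiveCharMatrix F).submatrix e e i' j ≠ 0).card =
          Fintype.card F * (Fintype.card F - 1) := by
      zify [Fintype.card_pos (α := F)]
      rw [← sum_projectiveCharMatrix_sq_mul_sq (e.injective.ne hii'), ← Equiv.sum_comp e,
        Finset.card_filter]
      push_cast
      refine Finset.sum_congr rfl fun j _ => ?_
      simp only [projectiveCharMatrix_sq_eq, Matrix.submatrix_apply]
      by_cases h : projectiveCharMatrix F (e i) (e j) = 0 <;>
        by_cases h' : projectiveCharMatrix F (e i') (e j) = 0 <;> simp [h, h']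
    have hsq : Fintype.card F * (Fintype.card F - 1) = 2 + 2 * p * ((m + 1) * k) := by
      zify [Fintype.card_pos (α := F)] at hm hk ⊢
      linear_combination (k : ℤ) * hm + (Fintype.card F + 1 : ℤ) * hk
    rw [hsupp, hsq, Nat.add_mul_mod_self_left, Nat.mod_eq_of_lt (by lia)]
  · rw [← sum_projectiveCharMatrix_mul hF (e.injective.ne hii'), ← Equiv.sum_comp e]
    rfl

/-- For odd `p ≥ 3`: (a) an `n × n` matrix good for `p` yields a `1 mod p` cover of `K_{2n}`
by `n` complete bipartite subgraphs; (b) if `n = q² + q + 1` with `q` a prime power and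
`q ≡ -1 (mod 2p)`, then an `n × n` matrix good for `p` exists. -/
theorem stmt_11 (p : ℕ) (hp : 3 ≤ p) (hodd : Odd p) :
    (∀ n : ℕ, ∀ M : Matrix (Fin n) (Fin n) ℤ, IsGoodMatrixFor p M →
      ∃ A B : Fin n → Finset (Fin (2 * n)), IsOneModPCover p (2 * n) n A B) ∧
    (∀ n q : ℕ, (∃ p' r : ℕ, p'.Prime ∧ 1 ≤ r ∧ q = p' ^ r) →
      q % (2 * p) = 2 * p - 1 → n = q ^ 2 + q + 1 →
      ∃ M : Matrix (Fin n) (Fin n) ℤ, IsGoodMatrixFor p M) := by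
  refine ⟨fun n M hM => hM.exists_isOneModPCover, ?_⟩
  rintro n q ⟨p', r, hp', hr, rfl⟩ hmod hn
  have : Fact p'.Prime := ⟨hp'⟩
  have : Fintype (GaloisField p' r) := Fintype.ofFinite _
  have hcard : Fintype.card (GaloisField p' r) = p' ^ r := by
    rw [Fintype.card_eq_nat_card, GaloisField.card p' r (by lia)]
  exact exists_isGoodMatrixFor_of_field hp (GaloisField p' r) (by rwa [hcard]) (by rwa [hcard])
end

section
/- Let F be a field of characteristic different from 2, let k ≥ 1, and suppose the image of k in F (under the canonical map ℤ → F) is not equal to any of 0, 1 or -1. Then for any k homogeneous linear forms ℓ_1,…,ℓ_k in the variables X_1,…,X_{k+1} over F, the polynomial S_{2k+1}^2(X_1,…,X_{k+1}, ℓ_1,…,ℓ_k) is not the zero polynomial. -/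
open MvPolynomial

/-- The bilinear form `(∑ u) (∑ v) - ∑ u_i v_i`, whose quadratic form is twice the second
elementary symmetric polynomial. -/
def esym2Bilin (F : Type*) [Field F] (n : ℕ) : LinearMap.BilinForm F (Fin n → F) :=
  LinearMap.mk₂ F (fun u v => (∑ i, u i) * (∑ i, v i) - ∑ i, u i * v i)
    (fun u u' v => by simp only [Pi.add_apply, add_mul, Finset.sum_add_distrib]; ring)
    (fun c u v => by
      simp only [Pi.smul_apply, smul_eq_mul, mul_assoc, ← Finset.mul_sum]; ring)
    (fun u v v' => by simp only [Pi.add_apply, mul_add, Finset.sum_add_distrib]; ring)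
    (fun c u v => by
      simp only [Pi.smul_apply, smul_eq_mul, mul_left_comm _ c, ← Finset.mul_sum]; ring)

lemma esym2Bilin_apply (F : Type*) [Field F] (n : ℕ) (u v : Fin n → F) :
    esym2Bilin F n u v = (∑ i, u i) * (∑ i, v i) - ∑ i, u i * v i := rfl

lemma esym2Bilin_isSymm (F : Type*) [Field F] (n : ℕ) : (esym2Bilin F n).IsSymm :=
  ⟨fun u v => by simp [esym2Bilin_apply, mul_comm]⟩

lemma two_mul_sum_lt_mul {R : Type*} [CommRing R] (n : ℕ) (u : Fin n → R) :
    2 * ∑ p ∈ Finset.univ.filter (fun p : Fin n × Fin n => p.1 < p.2), u p.1 * u p.2 =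
      (∑ i, u i) * (∑ i, u i) - ∑ i, u i * u i := by
  rw [Finset.sum_filter, Fintype.sum_prod_type]
  induction n with
  | zero => simp
  | succ n ih =>
    have h := ih (fun i => u i.succ)
    simp only [Fin.sum_univ_succ, Fin.succ_lt_succ_iff, Fin.succ_pos, Fin.not_lt_zero,
      if_true, if_false, zero_add, mul_add, h, ← Finset.mul_sum]
    ring

lemma two_mul_aeval_esym2 (F : Type*) [Field F] (n : ℕ) (u : Fin n → F) :
    2 * aeval u (esym2 F n) = esym2Bilin F n u u := by
  simp [esym2, esym2Bilin_apply, two_mul_sum_lt_mul]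

/-- The matrix `J - I` of size `n` is invertible when `n - 1` is nonzero in `F`. -/
lemma esym2Bilin_nondegenerate (F : Type*) [Field F] (n : ℕ) (hn : (n : F) ≠ 1) :
    (esym2Bilin F n).Nondegenerate := by
  refine (esym2Bilin_isSymm F n).isRefl.nondegenerate_iff_separatingLeft.mpr ?_
  intro u hu
  have hi : ∀ i, u i = ∑ j, u j := fun i => by
    have h := hu (Pi.single i 1)
    simp [esym2Bilin_apply, Pi.single_apply] at h
    linear_combination -h
  have hS : (∑ j, u j) * ((n : F) - 1) = 0 := by
    have h : ∑ i, u i = ∑ _i : Fin n, ∑ j, u j := Finset.sum_congr rfl fun i _ => hi i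
    rw [Finset.sum_const, Finset.card_univ, Fintype.card_fin, nsmul_eq_mul] at h
    linear_combination -h
  have h0 := (mul_eq_zero.mp hS).resolve_right (sub_ne_zero.mpr hn)
  funext i
  rw [hi i, h0, Pi.zero_apply]

/-- A totally isotropic subspace of a nondegenerate symmetric form has at most half the
dimension of the ambient space. -/
lemma two_mul_finrank_le_of_isotropic {F V : Type*} [Field F] [AddCommGroup V] [Module F V]
    [FiniteDimensional F V] (h2 : (2 : F) ≠ 0) (B : LinearMap.BilinForm F V)
    (hB : B.Nondegenerate) (hs : B.IsSymm) (W : Submodule F V) (hW : ∀ w ∈ W, B w w = 0) :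
    2 * Module.finrank F W ≤ Module.finrank F V := by
  have hle : W ≤ B.orthogonal W := by
    intro w hw v hv
    have h := hW (v + w) (W.add_mem hv hw)
    simp only [map_add, LinearMap.add_apply, hW v hv, hW w hw] at h
    have h' : 2 * B v w = 0 := by
      linear_combination h + hs.eq v w
    exact (mul_eq_zero.mp h').resolve_left h2
  have h1 := Submodule.finrank_mono hle
  have h3 := LinearMap.BilinForm.finrank_orthogonal hB W
  have h4 := Submodule.finrank_le W
  omega

lemma Fin.val_sub_succ_lt {k : ℕ} (hk : 1 ≤ k) (i : Fin (2 * k + 1)) : (i : ℕ) - (k + 1) < k := by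
  have := i.isLt
  omega

/-- The graph map `x ↦ (x_1, …, x_{k+1}, ℓ_1(x), …, ℓ_k(x))`. -/
def graphMap {F : Type*} [Field F] {k : ℕ} (hk : 1 ≤ k)
    (ℓ : Fin k → Fin (k + 1) → F) :
    (Fin (k + 1) → F) →ₗ[F] (Fin (2 * k + 1) → F) :=
  LinearMap.pi fun i =>
    if h : (i : ℕ) < k + 1 then LinearMap.proj ⟨i, h⟩
    else ∑ m : Fin (k + 1), ℓ ⟨(i : ℕ) - (k + 1), Fin.val_sub_succ_lt hk i⟩ m • LinearMap.proj m

lemma graphMap_injective {F : Type*} [Field F] {k : ℕ} (hk : 1 ≤ k)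
    (ℓ : Fin k → Fin (k + 1) → F) :
    Function.Injective (graphMap hk ℓ) := by
  intro x y hxy
  funext i
  have h := congrFun hxy ⟨i, by have := i.isLt; omega⟩
  simpa only [graphMap, LinearMap.pi_apply, i.isLt, dite_true, LinearMap.proj_apply] using h

/-- If `F` has characteristic different from 2 and the image of `k` in `F` is none of
`0`, `1`, `-1`, then for any `k` homogeneous linear forms `ℓ_1, …, ℓ_k` in
`X_1, …, X_{k+1}`, the polynomial `S_{2k+1}^2(X_1, …, X_{k+1}, ℓ_1, …, ℓ_k)` is nonzero. -/
theorem stmt_18 (F : Type*) [Field F] (hchar : (2 : F) ≠ 0)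
    (k : ℕ) (hk : 1 ≤ k) (hk0 : (k : F) ≠ 0) (hk1 : (k : F) ≠ 1) (hkm1 : (k : F) ≠ -1)
    (ℓ : Fin k → Fin (k + 1) → F) :
    aeval (fun i : Fin (2 * k + 1) =>
        if h' : (i : ℕ) < k + 1 then (X ⟨i, h'⟩ : MvPolynomial (Fin (k + 1)) F)
        else ∑ m : Fin (k + 1),
          C (ℓ ⟨(i : ℕ) - (k + 1), by have := i.isLt; omega⟩ m) * X m)
      (esym2 F (2 * k + 1)) ≠ 0 := by
  intro h0
  have hiso : ∀ w ∈ LinearMap.range (graphMap hk ℓ), esym2Bilin F (2 * k + 1) w w = 0 := by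
    rintro _ ⟨x, rfl⟩
    rw [← two_mul_aeval_esym2]
    have h := congrArg (aeval x) h0
    rw [← AlgHom.comp_apply, comp_aeval, map_zero] at h
    have hx : graphMap hk ℓ x = fun i : Fin (2 * k + 1) => aeval x
        (if h' : (i : ℕ) < k + 1 then (X ⟨i, h'⟩ : MvPolynomial (Fin (k + 1)) F)
        else ∑ m : Fin (k + 1),
          C (ℓ ⟨(i : ℕ) - (k + 1), by have := i.isLt; omega⟩ m) * X m) := by
      funext i
      rw [graphMap, LinearMap.pi_apply]
      split_ifs <;> simp
    rw [hx, h, mul_zero]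
  have hn : ((2 * k + 1 : ℕ) : F) ≠ 1 := by
    simpa using And.intro hchar hk0
  have h := two_mul_finrank_le_of_isotropic hchar _ (esym2Bilin_nondegenerate F _ hn)
    (esym2Bilin_isSymm F _) _ hiso
  rw [LinearMap.finrank_range_of_inj (graphMap_injective hk ℓ), Module.finrank_fin_fun,
    Module.finrank_fin_fun] at h
  omega
end
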